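/- Let m, d be integers with m ≥ d ≥ 2 and N = m^d. Then the stratified sample from the partition Ω*_\ (parameter θ = arctan(1/2)) satisfies 𝔼L₂²(P_{Ω*_\}) ≤ d/N^{1+1/d} − (2/45)·(1/N³)·(1/3^{d−2}). -/

import Mathlib

open MeasureTheory Real Set

noncomputable section

/-- The unit cube `[0,1]^d`. -/
def unitCube (d : ℕ) : Set (Fin d → ℝ) := Set.univ.pi fun _ => Set.Icc (0 : ℝ) 1

/-- The anchored half-open box `[0, z) = ∏ⱼ [0, zⱼ)`. -/
def lowerBox {d : ℕ} (z : Fin d → ℝ) : Set (Fin d → ℝ) := {y | ∀ i, 0 ≤ y i ∧ y i < z i}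

/-- The squared `L₂`-discrepancy of a point configuration `P` in `[0,1]^d`:
`∫_{[0,1]^d} (λ([0,z)) - (1/N) #{i : P i ∈ [0,z)})² dz`. -/
def L2sq {d : ℕ} {ι : Type} [Fintype ι] (P : ι → Fin d → ℝ) : ℝ :=
  ∫ z in unitCube d,
    ((volume (lowerBox z)).toReal
      - (Fintype.card ι : ℝ)⁻¹ * (Nat.card {i // P i ∈ lowerBox z} : ℝ)) ^ 2

/-- The joint distribution of the stratified sample associated to a partition `Ω`:
independent points, the `i`-th uniformly distributed on `Ω i`. -/
def stratified {d : ℕ} {ι : Type} [Fintype ι] (Ω : ι → Set (Fin d → ℝ)) :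
    Measure (ι → Fin d → ℝ) :=
  Measure.pi fun i => ProbabilityTheory.cond volume (Ω i)

/-- Expected squared `L₂`-discrepancy of the stratified sample from the partition `Ω`. -/
def expL2sq {d : ℕ} {ι : Type} [Fintype ι] (Ω : ι → Set (Fin d → ℝ)) : ℝ :=
  ∫ P, L2sq P ∂(stratified Ω)

/-- The rectangle `I = [0,2] × [0,1] ⊆ ℝ²`. -/
def I2 : Set (ℝ × ℝ) := Set.Icc (0 : ℝ) 2 ×ˢ Set.Icc (0 : ℝ) 1

open scoped Classical in
/-- The cell `Ω₁(θ)` of the one-parameter family of partitions of `[0,2] × [0,1]`. -/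
def Omega1 (θ : ℝ) : Set (ℝ × ℝ) :=
  if θ = π / 2 then Set.Icc (0 : ℝ) 1 ×ˢ Set.Icc (0 : ℝ) 1
  else if θ < arctan (1 / 2) then {p ∈ I2 | p.2 ≤ (1 - p.1) * tan θ + 1 / 2}
  else {p ∈ I2 | (p.1 - 1) * tan θ + p.2 ≤ 1 / 2}

/-- The cell `Ω₂(θ)`: the closure of the complement of `Ω₁(θ)` in `[0,2] × [0,1]`. -/
def Omega2 (θ : ℝ) : Set (ℝ × ℝ) := closure (I2 \ Omega1 θ)

/-- The anchor point `a = ((m-2)/m, (m-1)/m, …, (m-1)/m)`. -/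
def anchor (m d : ℕ) : Fin d → ℝ := fun j => if (j : ℕ) = 0 then ((m : ℝ) - 2) / m else ((m : ℝ) - 1) / m

/-- The two corner cells `a + (1/m)·(Ωᵢ(θ) × [0,1]^{d-2})`, `i = 1, 2`. -/
def cornerCell (m d : ℕ) (hd : 2 ≤ d) (θ : ℝ) (i : Fin 2) : Set (Fin d → ℝ) :=
  (fun x : Fin d → ℝ => fun j => anchor m d j + x j / m) ''
    {x : Fin d → ℝ |
      (x ⟨0, by omega⟩, x ⟨1, by omega⟩) ∈ (if i = 0 then Omega1 θ else Omega2 θ) ∧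
      ∀ j : Fin d, 2 ≤ (j : ℕ) → x j ∈ Set.Icc (0 : ℝ) 1}

/-- The axis-parallel grid cell of side `1/m` indexed by `k`. -/
def gridCell {d : ℕ} (m : ℕ) (k : Fin d → Fin m) : Set (Fin d → ℝ) :=
  Set.univ.pi fun j => Set.Ico ((k j : ℝ) / m) (((k j : ℝ) + 1) / m)

open scoped Classical in
/-- The partition `Ω*∼(θ)` of `[0,1]^d`: all grid cells of side `1/m` except the two
top-corner ones, which are replaced by the two cells `a + (1/m)·(Ωᵢ(θ) × [0,1]^{d-2})`. -/
def OmegaStarSim (m d : ℕ) (hd : 2 ≤ d) (θ : ℝ) : (Fin d → Fin m) → Set (Fin d → ℝ) :=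
  fun k =>
    if ∀ j : Fin d, (k j : ℕ) = (if (j : ℕ) = 0 then m - 2 else m - 1) then
      cornerCell m d hd θ 0
    else if ∀ j : Fin d, (k j : ℕ) = m - 1 then cornerCell m d hd θ 1
    else gridCell m k

end

open ProbabilityTheory

lemma lowerBox_eq_pi {d : ℕ} (z : Fin d → ℝ) :
    lowerBox z = Set.univ.pi fun i => Set.Ico 0 (z i) := by
  ext y; simp [lowerBox]

lemma measurableSet_lowerBox {d : ℕ} (z : Fin d → ℝ) : MeasurableSet (lowerBox z) := by
  rw [lowerBox_eq_pi]
  exact MeasurableSet.univ_pi fun _ => measurableSet_Ico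

lemma volume_lowerBox {d : ℕ} (z : Fin d → ℝ) :
    volume (lowerBox z) = ∏ i, ENNReal.ofReal (z i) := by
  rw [lowerBox_eq_pi, Real.volume_pi_Ico]
  simp

lemma natCard_mem_lowerBox {d : ℕ} {ι : Type} [Fintype ι] (P : ι → Fin d → ℝ) (z : Fin d → ℝ) :
    (Nat.card {i // P i ∈ lowerBox z} : ℝ)
      = ∑ i, (lowerBox z).indicator (fun _ => (1 : ℝ)) (P i) := by
  classical
  rw [Nat.card_eq_fintype_card, Fintype.card_subtype]
  simp [Set.indicator_apply]

lemma variance_indicator_le {α : Type*} [MeasurableSpace α] (μ : Measure α)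
    [IsProbabilityMeasure μ] {s : Set α} (hs : MeasurableSet s) :
    Var[s.indicator (fun _ => (1 : ℝ)); μ] ≤ 1 / 4 := by
  have h := variance_le_sq_of_bounded (μ := μ) (a := 0) (b := 1)
    (X := s.indicator (fun _ => (1 : ℝ)))
    (Filter.Eventually.of_forall fun x => by
      by_cases hx : x ∈ s <;> simp [hx])
    (measurable_const.indicator hs).aemeasurable
  norm_num at h ⊢
  exact h

/-- The variance over the stratified sample of the discrepancy function at `z`, when the number of
points in `[0, z)` has the correct expectation. -/
lemma integral_discrepancy_sq {d : ℕ} {ι : Type} [Fintype ι] [Nonempty ι]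
    (μ : ι → Measure (Fin d → ℝ)) [∀ i, IsProbabilityMeasure (μ i)] (z : Fin d → ℝ)
    (hz : ∑ i, (μ i).real (lowerBox z) = Fintype.card ι * (volume (lowerBox z)).toReal) :
    ∫ P, ((volume (lowerBox z)).toReal
      - (Fintype.card ι : ℝ)⁻¹ * (Nat.card {i // P i ∈ lowerBox z} : ℝ)) ^ 2 ∂(Measure.pi μ)
      = ((Fintype.card ι : ℝ)⁻¹) ^ 2
        * ∑ i, Var[(lowerBox z).indicator (fun _ => (1 : ℝ)); μ i] := by
  have hmeas : Measurable ((lowerBox z).indicator (fun _ => (1 : ℝ))) :=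
    measurable_const.indicator (measurableSet_lowerBox z)
  have hcomp (i : ι) : Measurable
      (fun P : ι → Fin d → ℝ => (lowerBox z).indicator (fun _ => (1 : ℝ)) (P i)) :=
    hmeas.comp (measurable_pi_apply i)
  have hbound (i : ι) (P : ι → Fin d → ℝ) :
      ‖(lowerBox z).indicator (fun _ => (1 : ℝ)) (P i)‖ ≤ 1 := by
    by_cases h : P i ∈ lowerBox z <;> simp [h]
  have hLp (i : ι) : MemLp
      (fun P : ι → Fin d → ℝ => (lowerBox z).indicator (fun _ => (1 : ℝ)) (P i)) 2
      (Measure.pi μ) :=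
    MemLp.of_bound (hcomp i).aestronglyMeasurable 1 (Filter.Eventually.of_forall (hbound i))
  have hvar : Var[∑ i, fun P : ι → Fin d → ℝ =>
        (lowerBox z).indicator (fun _ => (1 : ℝ)) (P i); Measure.pi μ]
      = ∑ i, Var[(lowerBox z).indicator (fun _ => (1 : ℝ)); μ i] := by
    rw [IndepFun.variance_sum (fun i _ => hLp i)]
    · exact Finset.sum_congr rfl fun i _ =>
        (measurePreserving_eval μ i).variance_fun_comp hmeas.aemeasurable
    · intro i _ j _ hij
      exact (iIndepFun_pi (μ := μ)
        (X := fun _ => (lowerBox z).indicator (fun _ => (1 : ℝ)))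
        fun _ => hmeas.aemeasurable).indepFun hij
  have hmean : ∫ P : ι → Fin d → ℝ, ∑ i, (lowerBox z).indicator (fun _ => (1 : ℝ)) (P i)
      ∂(Measure.pi μ) = Fintype.card ι * (volume (lowerBox z)).toReal := by
    rw [integral_finsetSum _ fun i _ => (hLp i).integrable one_le_two, ← hz]
    refine Finset.sum_congr rfl fun i _ => ?_
    rw [integral_comp_eval (μ := μ) hmeas.aestronglyMeasurable,
      integral_indicator_const _ (measurableSet_lowerBox z)]
    simp
  have hN : (Fintype.card ι : ℝ) ≠ 0 := by simp
  rw [← hvar, variance_eq_integral (Finset.aemeasurable_sum _ fun i _ => (hcomp i).aemeasurable),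
    ← integral_const_mul]
  refine integral_congr_ae (Filter.Eventually.of_forall fun P => ?_)
  simp only [Finset.sum_apply, hmean, natCard_mem_lowerBox]
  field_simp
  ring

lemma measurable_discrepancy {d : ℕ} {ι : Type} [Fintype ι] :
    Measurable (Function.uncurry fun (P : ι → Fin d → ℝ) (z : Fin d → ℝ) =>
      ((volume (lowerBox z)).toReal
        - (Fintype.card ι : ℝ)⁻¹ * (Nat.card {i // P i ∈ lowerBox z} : ℝ)) ^ 2) := by
  simp only [natCard_mem_lowerBox, volume_lowerBox]
  refine ((Measurable.ennreal_toReal ?_).sub (measurable_const.mul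
    (Finset.measurable_sum _ fun i _ => ?_))).pow_const 2
  · fun_prop
  · have : MeasurableSet {p : (ι → Fin d → ℝ) × (Fin d → ℝ) | p.1 i ∈ lowerBox p.2} := by
      have h : {p : (ι → Fin d → ℝ) × (Fin d → ℝ) | p.1 i ∈ lowerBox p.2}
          = ⋂ j, {p | 0 ≤ p.1 i j} ∩ {p | p.1 i j < p.2 j} := by
        ext p; simp [lowerBox]
      rw [h]
      refine MeasurableSet.iInter fun j => ?_
      exact (measurableSet_le measurable_const (by fun_prop)).inter
        (measurableSet_lt (by fun_prop) (by fun_prop))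
    exact measurable_const.indicator this

lemma volume_unitCube (d : ℕ) : volume (unitCube d) = 1 := by
  rw [unitCube, volume_pi_pi]
  simp

/-- Bound for the expected discrepancy of an unbiased stratified sample by the variances of the
counting indicators. -/
lemma expL2sq_le_of_variance_le {d : ℕ} {ι : Type} [Fintype ι] [Nonempty ι]
    (Ω : ι → Set (Fin d → ℝ)) [∀ i, IsProbabilityMeasure (cond volume (Ω i))] (V : ℝ)
    (hunbiased : ∀ z ∈ unitCube d, ∑ i, (cond volume (Ω i)).real (lowerBox z)
      = Fintype.card ι * (volume (lowerBox z)).toReal)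
    (hV : ∀ z ∈ unitCube d,
      ∑ i, Var[(lowerBox z).indicator (fun _ => (1 : ℝ)); cond volume (Ω i)] ≤ V) :
    expL2sq Ω ≤ ((Fintype.card ι : ℝ)⁻¹) ^ 2 * V := by
  have hcube : MeasurableSet (unitCube d) := MeasurableSet.univ_pi fun _ => measurableSet_Icc
  have : IsProbabilityMeasure (volume.restrict (unitCube d)) :=
    ⟨by simp [volume_unitCube]⟩
  have hN : (0 : ℝ) < Fintype.card ι := by exact_mod_cast Fintype.card_pos
  have hint : Integrable (Function.uncurry fun (P : ι → Fin d → ℝ) (z : Fin d → ℝ) =>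
      ((volume (lowerBox z)).toReal
        - (Fintype.card ι : ℝ)⁻¹ * (Nat.card {i // P i ∈ lowerBox z} : ℝ)) ^ 2)
      ((Measure.pi fun i => cond volume (Ω i)).prod (volume.restrict (unitCube d))) := by
    refine Integrable.of_bound measurable_discrepancy.aestronglyMeasurable 1 ?_
    have hmem : ∀ᵐ p ∂((Measure.pi fun i => cond volume (Ω i)).prod
        (volume.restrict (unitCube d))), p.2 ∈ unitCube d :=
      Measure.quasiMeasurePreserving_snd.ae (ae_restrict_mem hcube)
    filter_upwards [hmem] with ⟨P, z⟩ hz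
    have hvol : (volume (lowerBox z)).toReal ≤ 1 := by
      refine ENNReal.toReal_le_of_le_ofReal zero_le_one ?_
      rw [volume_lowerBox, ENNReal.ofReal_one]
      exact Finset.prod_le_one' fun i _ => ENNReal.ofReal_le_one.2 (hz i (Set.mem_univ i)).2
    have hcard : (Fintype.card ι : ℝ)⁻¹ * (Nat.card {i // P i ∈ lowerBox z} : ℝ) ≤ 1 := by
      rw [inv_mul_le_one₀ hN, ← Nat.card_eq_fintype_card]
      exact_mod_cast Nat.card_le_card_of_injective _ Subtype.val_injective
    have h0 : 0 ≤ (Fintype.card ι : ℝ)⁻¹ * (Nat.card {i // P i ∈ lowerBox z} : ℝ) := by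
      positivity
    have h0' : 0 ≤ (volume (lowerBox z)).toReal := ENNReal.toReal_nonneg
    rw [Function.uncurry_apply_pair, Real.norm_of_nonneg (sq_nonneg _), sq_le_one_iff_abs_le_one,
      abs_le]
    constructor <;> linarith
  unfold expL2sq L2sq stratified
  rw [integral_integral_swap hint]
  calc _ ≤ ∫ z in unitCube d, ((Fintype.card ι : ℝ)⁻¹) ^ 2 * V := by
        refine setIntegral_mono_on hint.integral_prod_right (integrable_const _) hcube fun z hz => ?_
        rw [integral_discrepancy_sq _ z (hunbiased z hz)]
        exact mul_le_mul_of_nonneg_left (hV z hz) (sq_nonneg _)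
    _ = _ := by simp

lemma mem_Omega1_arctan_half {p : ℝ × ℝ} :
    p ∈ Omega1 (arctan (1 / 2)) ↔ p ∈ I2 ∧ p.1 / 2 + p.2 ≤ 1 := by
  rw [Omega1, if_neg (arctan_lt_pi_div_two _).ne, if_neg (lt_irrefl _), tan_arctan]
  refine and_congr_right fun _ => ?_
  constructor <;> intro h <;> linarith

lemma isClosed_I2 : IsClosed I2 := isClosed_Icc.prod isClosed_Icc

lemma isClosed_Omega1_arctan_half : IsClosed (Omega1 (arctan (1 / 2))) := by
  have h : Omega1 (arctan (1 / 2)) = I2 ∩ {p | p.1 / 2 + p.2 ≤ 1} := by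
    ext p; exact mem_Omega1_arctan_half
  rw [h]
  exact isClosed_I2.inter (isClosed_le (by fun_prop) continuous_const)

lemma mem_Omega2_of_lt {p : ℝ × ℝ} (hp : p ∈ I2) (h : 1 < p.1 / 2 + p.2) :
    p ∈ Omega2 (arctan (1 / 2)) :=
  subset_closure ⟨hp, fun hp' => (mem_Omega1_arctan_half.1 hp').2.not_gt h⟩

lemma of_mem_Omega2 {p : ℝ × ℝ} (hp : p ∈ Omega2 (arctan (1 / 2))) :
    p ∈ I2 ∧ 1 ≤ p.1 / 2 + p.2 := by
  have hcl : IsClosed (I2 ∩ {p : ℝ × ℝ | 1 ≤ p.1 / 2 + p.2}) :=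
    isClosed_I2.inter (isClosed_le continuous_const (by fun_prop))
  refine closure_minimal ?_ hcl hp
  rintro q ⟨hq, hq'⟩
  refine ⟨hq, ?_⟩
  by_contra hlt
  exact hq' (mem_Omega1_arctan_half.2 ⟨hq, (not_le.1 hlt).le⟩)

/-- The rescaled affine form whose level set `1` separates the two corner cells. -/
noncomputable def cornerForm (m d : ℕ) (hd : 2 ≤ d) (x : Fin d → ℝ) : ℝ :=
  (m : ℝ) * (x ⟨0, by omega⟩ - anchor m d ⟨0, by omega⟩) / 2
    + (m : ℝ) * (x ⟨1, by omega⟩ - anchor m d ⟨1, by omega⟩)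

lemma mem_cornerCell_iff {m d : ℕ} (hd : 2 ≤ d) (hm : 0 < m) (θ : ℝ) (i : Fin 2)
    (x : Fin d → ℝ) :
    x ∈ cornerCell m d hd θ i ↔
      ((m : ℝ) * (x ⟨0, by omega⟩ - anchor m d ⟨0, by omega⟩),
        (m : ℝ) * (x ⟨1, by omega⟩ - anchor m d ⟨1, by omega⟩))
          ∈ (if i = 0 then Omega1 θ else Omega2 θ) ∧
      ∀ j : Fin d, 2 ≤ (j : ℕ) → (m : ℝ) * (x j - anchor m d j) ∈ Set.Icc (0 : ℝ) 1 := by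
  have hm' : (m : ℝ) ≠ 0 := by positivity
  constructor
  · rintro ⟨y, ⟨hy, hy'⟩, rfl⟩
    have h (j : Fin d) : (m : ℝ) * (anchor m d j + y j / m - anchor m d j) = y j := by
      field_simp; ring
    simpa only [h] using And.intro hy hy'
  · intro h
    refine ⟨fun j => (m : ℝ) * (x j - anchor m d j), h, ?_⟩
    ext j
    field_simp
    ring

lemma measurableSet_cornerCell {m d : ℕ} (hd : 2 ≤ d) (hm : 0 < m) (i : Fin 2) :
    MeasurableSet (cornerCell m d hd (arctan (1 / 2)) i) := by
  have hcl : IsClosed (if i = 0 then Omega1 (arctan (1 / 2)) else Omega2 (arctan (1 / 2))) := by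
    split_ifs
    · exact isClosed_Omega1_arctan_half
    · exact isClosed_closure
  have h : cornerCell m d hd (arctan (1 / 2)) i =
      (fun x : Fin d → ℝ => ((m : ℝ) * (x ⟨0, by omega⟩ - anchor m d ⟨0, by omega⟩),
        (m : ℝ) * (x ⟨1, by omega⟩ - anchor m d ⟨1, by omega⟩))) ⁻¹'
          (if i = 0 then Omega1 (arctan (1 / 2)) else Omega2 (arctan (1 / 2))) ∩
      ⋂ j : Fin d, ⋂ _ : 2 ≤ (j : ℕ),
        (fun x : Fin d → ℝ => (m : ℝ) * (x j - anchor m d j)) ⁻¹' Set.Icc (0 : ℝ) 1 := by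
    ext x
    rw [mem_cornerCell_iff hd hm]
    simp only [Set.mem_inter_iff, Set.mem_iInter, Set.mem_preimage]
  rw [h]
  refine (IsClosed.inter (hcl.preimage (by fun_prop)) ?_).measurableSet
  exact isClosed_iInter fun j => isClosed_iInter fun _ => isClosed_Icc.preimage (by fun_prop)

lemma mul_sub_anchor_mem_Icc_iff {m d : ℕ} (hm : 0 < m) (j : Fin d) (t : ℝ) :
    (m : ℝ) * (t - anchor m d j) ∈ Set.Icc (0 : ℝ) (if (j : ℕ) = 0 then 2 else 1) ↔
      t ∈ Set.Icc (anchor m d j) 1 := by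
  have hm' : (0 : ℝ) < m := by exact_mod_cast hm
  have h : (m : ℝ) * (1 - anchor m d j) = if (j : ℕ) = 0 then 2 else 1 := by
    unfold anchor; split_ifs <;> field_simp <;> ring
  rw [← h, Set.mem_Icc, Set.mem_Icc, mul_nonneg_iff_of_pos_left hm', mul_le_mul_iff_right₀ hm']
  simp

lemma mem_Icc_anchor_iff {m d : ℕ} (hd : 2 ≤ d) (hm : 0 < m) (x : Fin d → ℝ) :
    x ∈ Set.Icc (anchor m d) 1 ↔
      ((m : ℝ) * (x ⟨0, by omega⟩ - anchor m d ⟨0, by omega⟩),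
        (m : ℝ) * (x ⟨1, by omega⟩ - anchor m d ⟨1, by omega⟩)) ∈ I2 ∧
      ∀ j : Fin d, 2 ≤ (j : ℕ) → (m : ℝ) * (x j - anchor m d j) ∈ Set.Icc (0 : ℝ) 1 := by
  have h : x ∈ Set.Icc (anchor m d) 1 ↔ ∀ j : Fin d, (m : ℝ) * (x j - anchor m d j) ∈
      Set.Icc (0 : ℝ) (if (j : ℕ) = 0 then 2 else 1) := by
    simp only [mul_sub_anchor_mem_Icc_iff hm, Set.mem_Icc, Pi.le_def, Pi.one_apply, forall_and]
  rw [h]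
  constructor
  · intro hx
    refine ⟨⟨by simpa using hx ⟨0, by omega⟩, by simpa using hx ⟨1, by omega⟩⟩, fun j hj => ?_⟩
    simpa [show (j : ℕ) ≠ 0 by omega] using hx j
  · rintro ⟨⟨h0, h1⟩, h2⟩ ⟨j, hj⟩
    rcases j with _ | _ | j
    · simpa using h0
    · simpa using h1
    · simpa using h2 ⟨j + 1 + 1, hj⟩ (by simp)

lemma mem_cornerCell_zero_iff {m d : ℕ} (hd : 2 ≤ d) (hm : 0 < m) (x : Fin d → ℝ) :
    x ∈ cornerCell m d hd (arctan (1 / 2)) 0 ↔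
      x ∈ Set.Icc (anchor m d) 1 ∧ cornerForm m d hd x ≤ 1 := by
  rw [mem_cornerCell_iff hd hm, mem_Icc_anchor_iff hd hm, if_pos rfl, mem_Omega1_arctan_half,
    cornerForm]
  tauto

lemma volume_cornerForm_eq {m d : ℕ} (hd : 2 ≤ d) (hm : 0 < m) (c : ℝ) :
    volume {x | cornerForm m d hd x = c} = 0 := by
  have hm' : (m : ℝ) ≠ 0 := by positivity
  let S : AffineSubspace ℝ (Fin d → ℝ) :=
    { carrier := {x | cornerForm m d hd x = c}
      smul_vsub_vadd_mem' := by
        intro t p q r hp hq hr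
        simp only [Set.mem_ofPred_eq, cornerForm, vsub_eq_sub, vadd_eq_add, Pi.add_apply,
          Pi.smul_apply, Pi.sub_apply, smul_eq_mul] at hp hq hr ⊢
        linear_combination t * hp - t * hq + hr }
  refine Measure.addHaar_affineSubspace volume S fun hS => ?_
  have hall (x : Fin d → ℝ) : cornerForm m d hd x = c :=
    show x ∈ S from hS ▸ AffineSubspace.mem_top ℝ _ x
  have h0 := hall 0
  have h1 := hall 1
  simp only [cornerForm, Pi.zero_apply, Pi.one_apply] at h0 h1
  have : (m : ℝ) * (3 / 2) = 0 := by linear_combination h1 - h0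
  simp [hm'] at this

lemma cornerCell_one_ae_eq {m d : ℕ} (hd : 2 ≤ d) (hm : 0 < m) :
    cornerCell m d hd (arctan (1 / 2)) 1 =ᵐ[volume]
      (Set.Icc (anchor m d) 1 \ cornerCell m d hd (arctan (1 / 2)) 0 : Set (Fin d → ℝ)) := by
  have hne : ∀ᵐ x : Fin d → ℝ, cornerForm m d hd x ≠ 1 := by
    simpa [ae_iff] using volume_cornerForm_eq hd hm 1
  rw [Filter.eventuallyEq_set]
  filter_upwards [hne] with x hx
  rw [Set.mem_sdiff, mem_cornerCell_zero_iff hd hm, mem_cornerCell_iff hd hm, if_neg one_ne_zero]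
  constructor
  · rintro ⟨h, h'⟩
    have h2 := of_mem_Omega2 h
    exact ⟨(mem_Icc_anchor_iff hd hm x).2 ⟨h2.1, h'⟩, fun h3 => hx (le_antisymm h3.2 h2.2)⟩
  · rintro ⟨h, h'⟩
    have h2 := (mem_Icc_anchor_iff hd hm x).1 h
    exact ⟨mem_Omega2_of_lt h2.1 (not_le.1 fun h3 => h' ⟨h, h3⟩), h2.2⟩

lemma volume_cornerCell_inter_add {m d : ℕ} (hd : 2 ≤ d) (hm : 0 < m) (A : Set (Fin d → ℝ)) :
    volume (cornerCell m d hd (arctan (1 / 2)) 0 ∩ A)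
      + volume (cornerCell m d hd (arctan (1 / 2)) 1 ∩ A)
      = volume (Set.Icc (anchor m d) 1 ∩ A) := by
  have hsub : cornerCell m d hd (arctan (1 / 2)) 0 ⊆ Set.Icc (anchor m d) 1 :=
    fun x hx => ((mem_cornerCell_zero_iff hd hm x).1 hx).1
  rw [measure_congr ((cornerCell_one_ae_eq hd hm).inter (Filter.EventuallyEq.refl _ A)),
    ← measure_inter_add_sdiff (Set.Icc (anchor m d) 1 ∩ A) (measurableSet_cornerCell hd hm 0)]
  congr 2
  · ext x; constructor
    · exact fun h => ⟨⟨hsub h.1, h.2⟩, h.1⟩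
    · exact fun h => ⟨h.2, h.1.2⟩
  · ext x; constructor
    · exact fun h => ⟨⟨h.1.1, h.2⟩, h.1.2⟩
    · exact fun h => ⟨⟨h.1.1, h.2⟩, h.1.2⟩

lemma volume_cornerCell_zero_eq_one {m d : ℕ} (hd : 2 ≤ d) (hm : 0 < m) :
    volume (cornerCell m d hd (arctan (1 / 2)) 0)
      = volume (cornerCell m d hd (arctan (1 / 2)) 1) := by
  have hm' : (m : ℝ) ≠ 0 := by positivity
  have hmp : MeasurePreserving (fun x : Fin d → ℝ => (anchor m d + 1) - x) volume volume :=
    Measure.measurePreserving_sub_left volume _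
  rw [← hmp.measure_preimage (measurableSet_cornerCell hd hm 0).nullMeasurableSet]
  refine measure_congr (Filter.EventuallyEq.trans ?_ (cornerCell_one_ae_eq hd hm).symm)
  have hne : ∀ᵐ x : Fin d → ℝ, cornerForm m d hd x ≠ 1 := by
    simpa [ae_iff] using volume_cornerForm_eq hd hm 1
  rw [Filter.eventuallyEq_set]
  filter_upwards [hne] with x hx
  have hform : cornerForm m d hd (anchor m d + 1 - x) = 2 - cornerForm m d hd x := by
    simp only [cornerForm, anchor, Pi.add_apply, Pi.sub_apply, Pi.one_apply]
    norm_num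
    field_simp
    ring
  have hbox : anchor m d + 1 - x ∈ Set.Icc (anchor m d) 1 ↔ x ∈ Set.Icc (anchor m d) 1 := by
    rw [Set.mem_Icc, Set.mem_Icc, le_sub_iff_add_le, sub_le_iff_le_add, add_le_add_iff_left,
      add_comm (1 : Fin d → ℝ) x, add_le_add_iff_right, and_comm]
  rw [Set.mem_preimage, Set.mem_sdiff, mem_cornerCell_zero_iff hd hm, mem_cornerCell_zero_iff hd hm,
    hform, hbox]
  refine and_congr_right fun h => ?_
  simp only [h, true_and, not_le]
  constructor
  · intro h'
    exact lt_of_le_of_ne (by linarith) hx.symm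
  · intro h'
    linarith

lemma volume_Icc_anchor {m d : ℕ} (hd : 2 ≤ d) (hm : 0 < m) :
    volume (Set.Icc (anchor m d) 1) = 2 * ENNReal.ofReal (1 / m) ^ d := by
  have hm' : (m : ℝ) ≠ 0 := by positivity
  obtain ⟨e, rfl⟩ : ∃ e, d = e + 1 := ⟨d - 1, by omega⟩
  rw [Real.volume_Icc_pi, Fin.prod_univ_succ]
  have h0 : (1 : Fin (e + 1) → ℝ) 0 - anchor m (e + 1) 0 = 2 * (1 / m) := by
    simp [anchor]; field_simp; ring
  have h1 (i : Fin e) : (1 : Fin (e + 1) → ℝ) i.succ - anchor m (e + 1) i.succ = 1 / m := by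
    simp [anchor]; field_simp; ring
  simp only [h0, h1, Finset.prod_const, Finset.card_univ, Fintype.card_fin]
  rw [ENNReal.ofReal_mul zero_le_two, pow_succ']
  simp [mul_assoc]

lemma volume_cornerCell {m d : ℕ} (hd : 2 ≤ d) (hm : 0 < m) (i : Fin 2) :
    volume (cornerCell m d hd (arctan (1 / 2)) i) = ENNReal.ofReal (1 / m) ^ d := by
  have h := volume_cornerCell_inter_add hd hm Set.univ
  rw [Set.inter_univ, Set.inter_univ, Set.inter_univ, volume_Icc_anchor hd hm,
    ← volume_cornerCell_zero_eq_one hd hm, ← two_mul] at h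
  have h0 := (ENNReal.mul_right_inj two_ne_zero ENNReal.ofNat_ne_top).1 h
  fin_cases i
  · exact h0
  · exact (volume_cornerCell_zero_eq_one hd hm).symm.trans h0

lemma mem_gridCell_iff {m d : ℕ} (hm : 0 < m) (k : Fin d → Fin m) (x : Fin d → ℝ) :
    x ∈ gridCell m k ↔ ∀ j, (k j : ℝ) ≤ m * x j ∧ (m : ℝ) * x j < k j + 1 := by
  have hm' : (0 : ℝ) < m := by exact_mod_cast hm
  simp only [gridCell, Set.mem_univ_pi, Set.mem_Ico, div_le_iff₀' hm', lt_div_iff₀' hm']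

lemma measurableSet_gridCell {m d : ℕ} (k : Fin d → Fin m) : MeasurableSet (gridCell m k) :=
  MeasurableSet.univ_pi fun _ => measurableSet_Ico

lemma volume_gridCell {m d : ℕ} (k : Fin d → Fin m) :
    volume (gridCell m k) = ENNReal.ofReal (1 / m) ^ d := by
  rw [gridCell, Real.volume_pi_Ico]
  have h (j : Fin d) : ((k j : ℝ) + 1) / m - (k j : ℝ) / m = 1 / m := by ring
  simp [h]

lemma pairwise_disjoint_gridCell {m d : ℕ} (hm : 0 < m) :
    Pairwise (Function.onFun Disjoint (gridCell (d := d) m)) := by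
  intro k l hkl
  refine Set.disjoint_left.2 fun x hk hl => hkl ?_
  rw [mem_gridCell_iff hm] at hk hl
  ext j
  have h1 : (k j : ℝ) < l j + 1 := (hk j).1.trans_lt (hl j).2
  have h2 : (l j : ℝ) < k j + 1 := (hl j).1.trans_lt (hk j).2
  norm_cast at h1 h2
  omega

lemma exists_mem_gridCell {m d : ℕ} (hm : 0 < m) {x : Fin d → ℝ} (hx : ∀ j, 0 ≤ x j ∧ x j < 1) :
    ∃ k, x ∈ gridCell m k := by
  have hm' : (0 : ℝ) < m := by exact_mod_cast hm
  have h0 (j : Fin d) : 0 ≤ (m : ℝ) * x j := mul_nonneg hm'.le (hx j).1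
  refine ⟨fun j => ⟨⌊(m : ℝ) * x j⌋₊, ?_⟩, (mem_gridCell_iff hm _ _).2 fun j => ?_⟩
  · rw [Nat.floor_lt (h0 j)]
    exact mul_lt_of_lt_one_right hm' (hx j).2
  · exact ⟨Nat.floor_le (h0 j), Nat.lt_floor_add_one _⟩

lemma sum_volume_gridCell_inter_lowerBox {m d : ℕ} (hm : 0 < m) {z : Fin d → ℝ}
    (hz : z ∈ unitCube d) :
    ∑ k : Fin d → Fin m, volume (gridCell m k ∩ lowerBox z) = volume (lowerBox z) := by
  rw [← tsum_fintype (L := SummationFilter.unconditional _), ← measure_iUnion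
    (fun k l hkl => (pairwise_disjoint_gridCell hm hkl).mono inter_subset_left inter_subset_left)
    (fun k => (measurableSet_gridCell k).inter (measurableSet_lowerBox z)), ← Set.iUnion_inter]
  congr 1
  refine Set.inter_eq_right.2 fun x hx => Set.mem_iUnion.2 (exists_mem_gridCell hm fun j => ?_)
  exact ⟨(hx j).1, (hx j).2.trans_le (hz j (Set.mem_univ j)).2⟩

/-- The index of the first corner cell. -/
def cornerIndexZero (m d : ℕ) (hm : 2 ≤ m) : Fin d → Fin m :=
  fun j => if (j : ℕ) = 0 then ⟨m - 2, by omega⟩ else ⟨m - 1, by omega⟩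

/-- The index of the second corner cell. -/
def cornerIndexOne (m d : ℕ) (hm : 2 ≤ m) : Fin d → Fin m := fun _ => ⟨m - 1, by omega⟩

lemma cornerIndexZero_ne_cornerIndexOne {m d : ℕ} (hd : 2 ≤ d) (hm : 2 ≤ m) :
    cornerIndexZero m d hm ≠ cornerIndexOne m d hm := by
  intro h
  have h0 := congrArg Fin.val (congrFun h ⟨0, by omega⟩)
  simp only [cornerIndexZero, cornerIndexOne, if_true] at h0
  omega

lemma OmegaStarSim_cornerIndexZero {m d : ℕ} (hd : 2 ≤ d) (hm : 2 ≤ m) (θ : ℝ) :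
    OmegaStarSim m d hd θ (cornerIndexZero m d hm) = cornerCell m d hd θ 0 := by
  rw [OmegaStarSim, if_pos]
  intro j
  unfold cornerIndexZero
  split_ifs <;> rfl

lemma OmegaStarSim_cornerIndexOne {m d : ℕ} (hd : 2 ≤ d) (hm : 2 ≤ m) (θ : ℝ) :
    OmegaStarSim m d hd θ (cornerIndexOne m d hm) = cornerCell m d hd θ 1 := by
  rw [OmegaStarSim, if_neg, if_pos]
  · exact fun _ => rfl
  · intro h
    have h0 := h ⟨0, by omega⟩
    simp only [cornerIndexOne, if_true] at h0
    omega

lemma OmegaStarSim_of_ne {m d : ℕ} (hd : 2 ≤ d) (hm : 2 ≤ m) (θ : ℝ) {k : Fin d → Fin m}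
    (h0 : k ≠ cornerIndexZero m d hm) (h1 : k ≠ cornerIndexOne m d hm) :
    OmegaStarSim m d hd θ k = gridCell m k := by
  rw [OmegaStarSim, if_neg, if_neg]
  · exact fun h => h1 (funext fun j => Fin.ext (h j))
  · refine fun h => h0 (funext fun j => Fin.ext ((h j).trans ?_))
    unfold cornerIndexZero
    split_ifs <;> rfl

lemma gridCell_cornerIndex_union {m d : ℕ} (hd : 2 ≤ d) (hm : 2 ≤ m) :
    gridCell m (cornerIndexZero m d hm) ∪ gridCell m (cornerIndexOne m d hm)
      = Set.univ.pi fun j => Set.Ico (anchor m d j) 1 := by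
  have hm' : (0 : ℝ) < m := by positivity
  have e1 : ((m - 1 : ℕ) : ℝ) = m - 1 := by push_cast [show 1 ≤ m by omega]; rfl
  have e2 : ((m - 2 : ℕ) : ℝ) = m - 2 := by push_cast [hm]; rfl
  have hone (x : Fin d → ℝ) : x ∈ gridCell m (cornerIndexOne m d hm) ↔
      ∀ j, (m : ℝ) - 1 ≤ m * x j ∧ (m : ℝ) * x j < m := by
    rw [mem_gridCell_iff (by omega)]
    simp [cornerIndexOne, e1]
  have hzero (x : Fin d → ℝ) : x ∈ gridCell m (cornerIndexZero m d hm) ↔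
      ∀ j : Fin d, if (j : ℕ) = 0 then (m : ℝ) - 2 ≤ m * x j ∧ (m : ℝ) * x j < m - 1
        else (m : ℝ) - 1 ≤ m * x j ∧ (m : ℝ) * x j < m := by
    rw [mem_gridCell_iff (by omega)]
    refine forall_congr' fun j => ?_
    by_cases hj : (j : ℕ) = 0
    · simp only [cornerIndexZero, hj, if_true, e2]
      rw [show (m : ℝ) - 2 + 1 = m - 1 by ring]
    · simp only [cornerIndexZero, hj, if_false, e1]
      rw [show (m : ℝ) - 1 + 1 = m by ring]
  have hbox (x : Fin d → ℝ) : x ∈ (Set.univ.pi fun j => Set.Ico (anchor m d j) 1) ↔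
      ∀ j : Fin d, (if (j : ℕ) = 0 then (m : ℝ) - 2 else m - 1) ≤ m * x j
        ∧ (m : ℝ) * x j < m := by
    rw [Set.mem_univ_pi]
    refine forall_congr' fun j => ?_
    rw [Set.mem_Ico, mul_lt_iff_lt_one_right hm', anchor]
    split_ifs <;> rw [div_le_iff₀' hm']
  ext x
  rw [Set.mem_union, hone, hzero, hbox]
  constructor
  · rintro (h | h) j
    · have := h j
      split_ifs at this ⊢ <;> constructor <;> linarith [this.1, this.2]
    · have := h j
      split_ifs <;> constructor <;> linarith [this.1, this.2]
  · intro h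
    by_cases hx : (m : ℝ) * x ⟨0, by omega⟩ < m - 1
    · left
      intro j
      have := h j
      split_ifs at this ⊢ with hj
      · have hj0 : j = ⟨0, by omega⟩ := Fin.ext hj
        rw [← hj0] at hx
        exact ⟨this.1, hx⟩
      · exact this
    · right
      intro j
      have := h j
      split_ifs at this with hj
      · have hj0 : j = ⟨0, by omega⟩ := Fin.ext hj
        rw [← hj0] at hx
        exact ⟨not_lt.1 hx, this.2⟩
      · exact this

lemma volume_gridCell_corner_inter_add {m d : ℕ} (hd : 2 ≤ d) (hm : 2 ≤ m)
    {A : Set (Fin d → ℝ)} (hA : MeasurableSet A) :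
    volume (gridCell m (cornerIndexZero m d hm) ∩ A)
      + volume (gridCell m (cornerIndexOne m d hm) ∩ A) = volume (Set.Icc (anchor m d) 1 ∩ A) := by
  have hae : (Set.univ.pi fun j => Set.Ico (anchor m d j) 1 : Set (Fin d → ℝ)) =ᵐ[volume]
      Set.Icc (anchor m d) 1 := Measure.univ_pi_Ico_ae_eq_Icc
  rw [← measure_congr (hae.inter (Filter.EventuallyEq.refl _ A)),
    ← gridCell_cornerIndex_union hd hm, Set.union_inter_distrib_right, measure_union]
  · exact (pairwise_disjoint_gridCell (by omega)
      (cornerIndexZero_ne_cornerIndexOne hd hm)).mono inter_subset_left inter_subset_left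
  · exact (measurableSet_gridCell _).inter hA

lemma measurableSet_OmegaStarSim {m d : ℕ} (hd : 2 ≤ d) (hm : 2 ≤ m) (k : Fin d → Fin m) :
    MeasurableSet (OmegaStarSim m d hd (arctan (1 / 2)) k) := by
  unfold OmegaStarSim
  split_ifs
  · exact measurableSet_cornerCell hd (by omega) 0
  · exact measurableSet_cornerCell hd (by omega) 1
  · exact measurableSet_gridCell k

lemma volume_OmegaStarSim {m d : ℕ} (hd : 2 ≤ d) (hm : 2 ≤ m) (k : Fin d → Fin m) :
    volume (OmegaStarSim m d hd (arctan (1 / 2)) k) = ENNReal.ofReal (1 / m) ^ d := by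
  unfold OmegaStarSim
  split_ifs
  · exact volume_cornerCell hd (by omega) 0
  · exact volume_cornerCell hd (by omega) 1
  · exact volume_gridCell k

lemma sum_volume_OmegaStarSim_inter_lowerBox {m d : ℕ} (hd : 2 ≤ d) (hm : 2 ≤ m) {z : Fin d → ℝ}
    (hz : z ∈ unitCube d) :
    ∑ k, volume (OmegaStarSim m d hd (arctan (1 / 2)) k ∩ lowerBox z) = volume (lowerBox z) := by
  classical
  have hne := cornerIndexZero_ne_cornerIndexOne hd hm
  rw [← sum_volume_gridCell_inter_lowerBox (m := m) (by omega) hz,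
    ← Finset.sum_add_sum_compl {cornerIndexZero m d hm, cornerIndexOne m d hm},
    ← Finset.sum_add_sum_compl {cornerIndexZero m d hm, cornerIndexOne m d hm}
      (fun k => volume (gridCell m k ∩ lowerBox z)),
    Finset.sum_pair hne, Finset.sum_pair hne, OmegaStarSim_cornerIndexZero,
    OmegaStarSim_cornerIndexOne, volume_cornerCell_inter_add hd (by omega),
    volume_gridCell_corner_inter_add hd hm (measurableSet_lowerBox z)]
  congr 1
  refine Finset.sum_congr rfl fun k hk => ?_
  simp only [Finset.mem_compl, Finset.mem_insert, Finset.mem_singleton, not_or] at hk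
  rw [OmegaStarSim_of_ne hd hm _ hk.1 hk.2]

lemma isProbabilityMeasure_cond_OmegaStarSim {m d : ℕ} (hd : 2 ≤ d) (hm : 2 ≤ m)
    (k : Fin d → Fin m) :
    IsProbabilityMeasure (cond volume (OmegaStarSim m d hd (arctan (1 / 2)) k)) := by
  have hm' : (0 : ℝ) < m := by positivity
  refine cond_isProbabilityMeasure_of_finite ?_ ?_ <;> rw [volume_OmegaStarSim hd hm]
  · exact pow_ne_zero _ (ENNReal.ofReal_pos.2 (by positivity)).ne'
  · exact ENNReal.pow_ne_top ENNReal.ofReal_ne_top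

lemma sum_cond_OmegaStarSim_lowerBox {m d : ℕ} (hd : 2 ≤ d) (hm : 2 ≤ m) {z : Fin d → ℝ}
    (hz : z ∈ unitCube d) :
    ∑ k, (cond volume (OmegaStarSim m d hd (arctan (1 / 2)) k)).real (lowerBox z)
      = Fintype.card (Fin d → Fin m) * (volume (lowerBox z)).toReal := by
  have hfin (k : Fin d → Fin m) :
      volume (OmegaStarSim m d hd (arctan (1 / 2)) k ∩ lowerBox z) ≠ ⊤ :=
    measure_ne_top_of_subset inter_subset_left (by
      rw [volume_OmegaStarSim hd hm]; exact ENNReal.pow_ne_top ENNReal.ofReal_ne_top)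
  simp only [measureReal_def, cond_apply (measurableSet_OmegaStarSim hd hm _),
    volume_OmegaStarSim hd hm, ENNReal.toReal_mul]
  rw [← Finset.mul_sum, ← ENNReal.toReal_sum fun k _ => hfin k,
    sum_volume_OmegaStarSim_inter_lowerBox hd hm hz]
  simp

lemma variance_indicator_lowerBox_cond_gridCell {m d : ℕ} (hm : 0 < m) (k : Fin d → Fin m)
    {z : Fin d → ℝ} (hz : z ∈ unitCube d) (hk : ∀ j, (k j : ℕ) ≠ ⌊(m : ℝ) * z j⌋₊) :
    Var[(lowerBox z).indicator (fun _ => (1 : ℝ)); cond volume (gridCell m k)] = 0 := by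
  have hm' : (0 : ℝ) < m := by exact_mod_cast hm
  have hz0 (j : Fin d) : 0 ≤ (m : ℝ) * z j := mul_nonneg hm'.le (hz j (Set.mem_univ j)).1
  have hmem : ∀ᵐ x ∂(cond volume (gridCell m k)), x ∈ gridCell m k :=
    ae_cond_mem (measurableSet_gridCell k)
  suffices ∃ c : ℝ, (lowerBox z).indicator (fun _ => (1 : ℝ))
      =ᵐ[cond volume (gridCell m k)] fun _ => c by
    obtain ⟨c, hc⟩ := this
    rw [variance_congr hc]
    by_cases hp : volume (gridCell m k) = 0
    · simp [cond_eq_zero_of_meas_eq_zero hp]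
    · have : IsProbabilityMeasure (cond volume (gridCell m k)) :=
        cond_isProbabilityMeasure_of_finite hp (by
          rw [volume_gridCell]; exact ENNReal.pow_ne_top ENNReal.ofReal_ne_top)
      simp [variance_eq_integral aemeasurable_const]
  by_cases h : ∃ j, ⌊(m : ℝ) * z j⌋₊ < k j
  · obtain ⟨j, hj⟩ := h
    refine ⟨0, ?_⟩
    filter_upwards [hmem] with x hx
    refine Set.indicator_of_notMem (fun hxz => ?_) _
    have h1 := ((mem_gridCell_iff hm k x).1 hx j).1
    have h2 := (Nat.floor_lt (hz0 j)).1 hj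
    have h3 := mul_lt_mul_of_pos_left (hxz j).2 hm'
    linarith
  · push Not at h
    refine ⟨1, ?_⟩
    filter_upwards [hmem] with x hx
    refine Set.indicator_of_mem (fun j => ?_) _
    have hx' := (mem_gridCell_iff hm k x).1 hx j
    have hlt : (k j : ℕ) + 1 ≤ ⌊(m : ℝ) * z j⌋₊ := lt_of_le_of_ne (h j) (hk j)
    have h2 : ((k j : ℕ) : ℝ) + 1 ≤ m * z j := by exact_mod_cast (Nat.le_floor_iff (hz0 j)).1 hlt
    exact ⟨nonneg_of_mul_nonneg_right ((Nat.cast_nonneg _).trans hx'.1) hm',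
      lt_of_mul_lt_mul_left (hx'.2.trans_le h2) hm'.le⟩

lemma card_filter_apply_eq_le {m d : ℕ} (j : Fin d) (w : ℕ) :
    (Finset.univ.filter fun k : Fin d → Fin m => (k j : ℕ) = w).card ≤ m ^ (d - 1) := by
  classical
  calc _ ≤ (Fintype.piFinset fun i : Fin d => if i = j then
          Finset.univ.filter fun a : Fin m => (a : ℕ) = w else Finset.univ).card := by
        refine Finset.card_le_card fun k hk => Fintype.mem_piFinset.2 fun i => ?_
        split_ifs with hi
        · subst hi; simpa using hk
        · exact Finset.mem_univ _
    _ = (Finset.univ.filter fun a : Fin m => (a : ℕ) = w).card * m ^ (d - 1) := by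
        rw [Fintype.card_piFinset, ← Finset.mul_prod_erase _ _ (Finset.mem_univ j), if_pos rfl]
        congr 1
        rw [Finset.prod_congr rfl (g := fun _ => m) fun i hi => by
          rw [if_neg (Finset.ne_of_mem_erase hi)]; simp]
        simp
    _ ≤ 1 * m ^ (d - 1) := by
        refine Nat.mul_le_mul_right _ (Finset.card_le_one.2 fun a ha b hb => Fin.ext ?_)
        simp only [Finset.mem_filter, Finset.mem_univ, true_and] at ha hb
        omega
    _ = _ := one_mul _

lemma sum_variance_OmegaStarSim_le {m d : ℕ} (hd : 2 ≤ d) (hm : 2 ≤ m) {z : Fin d → ℝ}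
    (hz : z ∈ unitCube d) :
    ∑ k, Var[(lowerBox z).indicator (fun _ => (1 : ℝ));
      cond volume (OmegaStarSim m d hd (arctan (1 / 2)) k)]
      ≤ 1 / 4 * (d * (m : ℝ) ^ (d - 1) + 2) := by
  classical
  have hind (p : Prop) [Decidable p] : (0 : ℝ) ≤ if p then 1 else 0 := by split_ifs <;> norm_num
  have hterm (k : Fin d → Fin m) : Var[(lowerBox z).indicator (fun _ => (1 : ℝ));
      cond volume (OmegaStarSim m d hd (arctan (1 / 2)) k)]
      ≤ 1 / 4 * ((∑ j, if (k j : ℕ) = ⌊(m : ℝ) * z j⌋₊ then (1 : ℝ) else 0)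
        + ((if k = cornerIndexZero m d hm then 1 else 0)
          + if k = cornerIndexOne m d hm then 1 else 0)) := by
    have := isProbabilityMeasure_cond_OmegaStarSim hd hm k
    have hle := variance_indicator_le (cond volume (OmegaStarSim m d hd (arctan (1 / 2)) k))
      (measurableSet_lowerBox z)
    have hs : (0 : ℝ) ≤ ∑ j, if (k j : ℕ) = ⌊(m : ℝ) * z j⌋₊ then (1 : ℝ) else 0 :=
      Finset.sum_nonneg fun j _ => hind _
    have hi0 := hind (k = cornerIndexZero m d hm)
    have hi1 := hind (k = cornerIndexOne m d hm)
    by_cases h0 : k = cornerIndexZero m d hm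
    · rw [if_pos h0]; linarith
    by_cases h1 : k = cornerIndexOne m d hm
    · rw [if_pos h1]; linarith
    by_cases hj : ∃ j, (k j : ℕ) = ⌊(m : ℝ) * z j⌋₊
    · obtain ⟨j, hj⟩ := hj
      have := Finset.single_le_sum (f := fun j => if (k j : ℕ) = ⌊(m : ℝ) * z j⌋₊ then (1 : ℝ) else 0)
        (fun j _ => hind _) (Finset.mem_univ j)
      simp only [hj, if_true] at this
      linarith
    · push Not at hj
      rw [OmegaStarSim_of_ne hd hm _ h0 h1,
        variance_indicator_lowerBox_cond_gridCell (by omega) k hz hj]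
      linarith
  refine (Finset.sum_le_sum fun k _ => hterm k).trans ?_
  rw [← Finset.mul_sum, Finset.sum_add_distrib, Finset.sum_add_distrib, Finset.sum_comm]
  simp only [Finset.sum_ite_eq', Finset.mem_univ, if_true]
  have hcount (j : Fin d) : (∑ k : Fin d → Fin m,
      if (k j : ℕ) = ⌊(m : ℝ) * z j⌋₊ then (1 : ℝ) else 0) ≤ (m : ℝ) ^ (d - 1) := by
    rw [Finset.sum_boole]
    exact_mod_cast card_filter_apply_eq_le j _
  have hsum := Finset.sum_le_sum fun j (_ : j ∈ Finset.univ) => hcount j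
  simp only [Finset.sum_const, Finset.card_univ, Fintype.card_fin, nsmul_eq_mul] at hsum
  linarith

lemma variance_bound_le {m d : ℕ} (hd : 2 ≤ d) (hm : 2 ≤ m) :
    (((m : ℝ) ^ d)⁻¹) ^ 2 * (1 / 4 * (d * (m : ℝ) ^ (d - 1) + 2))
      ≤ (d : ℝ) / ((m : ℝ) ^ d) ^ ((1 : ℝ) + 1 / d)
        - (2 / 45) * (1 / ((m : ℝ) ^ d) ^ 3) * (1 / (3 : ℝ) ^ (d - 2)) := by
  have hd' : (2 : ℝ) ≤ d := by exact_mod_cast hd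
  have hm' : (2 : ℝ) ≤ m := by exact_mod_cast hm
  have hm0 : (0 : ℝ) < m := by linarith
  have hpow : ((m : ℝ) ^ d) ^ ((1 : ℝ) + 1 / d) = (m : ℝ) ^ d * m := by
    rw [Real.rpow_add (by positivity), Real.rpow_one, one_div,
      Real.pow_rpow_inv_natCast hm0.le (by omega)]
  have hN : (m : ℝ) ^ d = m ^ (d - 1) * m := by rw [← pow_succ]; congr 1; omega
  have hthree : 1 / (3 : ℝ) ^ (d - 2) ≤ 1 := by
    rw [div_le_one (by positivity)]; exact one_le_pow₀ (by norm_num)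
  have ht : (1 : ℝ) ≤ (m : ℝ) ^ (d - 1) := one_le_pow₀ (by linarith)
  have htm : (m : ℝ) ≤ (m : ℝ) ^ (d - 1) := le_self_pow₀ (by linarith) (by omega)
  rw [hpow, hN]
  set t := (m : ℝ) ^ (d - 1)
  have ht0 : 0 < t := by linarith
  have hcorr : (2 / 45) * (1 / (t * m) ^ 3) * (1 / (3 : ℝ) ^ (d - 2))
      ≤ (2 / 45) * (1 / (t * m) ^ 2) := by
    calc _ ≤ (2 / 45) * (1 / (t * m) ^ 3) * 1 := by gcongr
      _ ≤ _ := by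
        rw [mul_one]
        gcongr
        · nlinarith
        · norm_num
  have hmain : (d : ℝ) / (t * m * m) = d * t / (t * m) ^ 2 := by field_simp
  have hdt : (4 : ℝ) ≤ d * t := by nlinarith
  calc _ = (1 / 4 * (d * t + 2)) / (t * m) ^ 2 := by field_simp
    _ ≤ (d * t - 2 / 45) / (t * m) ^ 2 := by gcongr; linarith
    _ = d * t / (t * m) ^ 2 - (2 / 45) * (1 / (t * m) ^ 2) := by ring
    _ ≤ _ := by rw [hmain]; linarith

/-- For integers `m ≥ d ≥ 2` and `N = m^d`, the stratified sample from the
partition `Ω*_\\ = Ω*∼(arctan (1/2))` satisfies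
`𝔼 L₂² ≤ d / N^(1 + 1/d) - (2/45)·(1/N³)·(1/3^(d-2))`. -/
theorem expL2sq_OmegaStarBackslash_le_bound (m d : ℕ) (hd : 2 ≤ d) (hm : d ≤ m) :
    expL2sq (OmegaStarSim m d hd (arctan (1 / 2)))
      ≤ (d : ℝ) / ((m : ℝ) ^ d) ^ ((1 : ℝ) + 1 / d)
        - (2 / 45) * (1 / ((m : ℝ) ^ d) ^ 3) * (1 / (3 : ℝ) ^ (d - 2)) := by
  have hm2 : 2 ≤ m := hd.trans hm
  have : Nonempty (Fin m) := ⟨⟨0, by omega⟩⟩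
  have := isProbabilityMeasure_cond_OmegaStarSim hd hm2
  have h := expL2sq_le_of_variance_le (OmegaStarSim m d hd (arctan (1 / 2))) _
    (fun z hz => sum_cond_OmegaStarSim_lowerBox hd hm2 hz)
    (fun z hz => sum_variance_OmegaStarSim_le hd hm2 hz)
  rw [show (Fintype.card (Fin d → Fin m) : ℝ) = (m : ℝ) ^ d by simp] at h
  exact h.trans (variance_bound_le hd hm2)
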